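/- Let n ≥ 1 and 0 ≤ 2i ≤ k. The map (g, (q_0,…,q_n)) ↦ (g·q_0, …, g·q_n) is a homeomorphism from {monic polynomials of degree 2i over ℝ with no real roots} × RX_{k−2i,n}^{0} onto the subspace of (n+1)-tuples of monic degree-k real polynomials that have no common real root and whose gcd in ℝ[z] has degree exactly 2i, i.e. onto Y_{k,n}^{2i} − Y_{k,n}^{2i−2}. (The decomposition underlying Lemma 3.3 of the paper.) -/

import Mathlib

open Polynomial

/-- The monic real polynomial of degree `k` with lower-order coefficient vector `c`. -/
noncomputable def toPolyR (k : ℕ) (c : Fin k → ℝ) : Polynomial ℝ :=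
  Polynomial.X ^ k + ∑ i : Fin k, Polynomial.C (c i) * Polynomial.X ^ (i : ℕ)

/-- The monic complex polynomial of degree `k` with lower-order coefficient vector `c`. -/
noncomputable def toPolyC (k : ℕ) (c : Fin k → ℂ) : Polynomial ℂ :=
  Polynomial.X ^ k + ∑ i : Fin k, Polynomial.C (c i) * Polynomial.X ^ (i : ℕ)

/-- `RX_{k,n}^l`: tuples of monic real degree-`k` polynomials with gcd of degree `≤ l`,
as a subset of `ℝ^{k(n+1)}` via coefficient vectors. -/
def RXset (k n l : ℕ) : Set (Fin (n + 1) → Fin k → ℝ) :=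
  {f | (Finset.univ.gcd fun j => toPolyR k (f j)).natDegree ≤ l}

/-- `X_{k,n}^l`: tuples of monic complex degree-`k` polynomials with gcd of degree `≤ l`. -/
def Xset (k n l : ℕ) : Set (Fin (n + 1) → Fin k → ℂ) :=
  {f | (Finset.univ.gcd fun j => toPolyC k (f j)).natDegree ≤ l}

/-- `Y_{k,n}^l`: elements of `RX_{k,n}^l` with no common real root. -/
def Yset (k n l : ℕ) : Set (Fin (n + 1) → Fin k → ℝ) :=
  {f | f ∈ RXset k n l ∧ ∀ x : ℝ, ∃ j, (toPolyR k (f j)).eval x ≠ 0}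

lemma toPolyR_coeff (k : ℕ) (c : Fin k → ℝ) (m : ℕ) :
    (toPolyR k c).coeff m = if h : m < k then c ⟨m, h⟩ else if m = k then 1 else 0 := by
  simp only [toPolyR, coeff_add, coeff_X_pow, finsetSum_coeff, coeff_C_mul, mul_ite, mul_one,
    mul_zero]
  split_ifs with h₁ h₂ h₂
  · omega
  · rw [Finset.sum_eq_zero, add_zero]
    intro i _
    rw [if_neg (by have := i.isLt; omega)]
  · rw [Finset.sum_eq_single ⟨m, h₂⟩] <;> simp +contextual [Fin.ext_iff, eq_comm]
  · rw [Finset.sum_eq_zero, add_zero]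
    intro i _
    rw [if_neg (by have := i.isLt; omega)]

lemma toPolyR_coeff_fin (k : ℕ) (c : Fin k → ℝ) (m : Fin k) : (toPolyR k c).coeff m = c m := by
  simp [toPolyR_coeff]

lemma toPolyR_injective (k : ℕ) : Function.Injective (toPolyR k) := fun c d h ↦ by
  ext m
  rw [← toPolyR_coeff_fin k c, h, toPolyR_coeff_fin]

lemma natDegree_toPolyR (k : ℕ) (c : Fin k → ℝ) : (toPolyR k c).natDegree = k := by
  refine natDegree_eq_of_le_of_coeff_ne_zero (natDegree_le_iff_coeff_eq_zero.2 fun m hm ↦ ?_) ?_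
  · rw [toPolyR_coeff, dif_neg (by omega), if_neg (by omega)]
  · simp [toPolyR_coeff]

lemma monic_toPolyR (k : ℕ) (c : Fin k → ℝ) : (toPolyR k c).Monic := by
  rw [Monic, leadingCoeff, natDegree_toPolyR]
  simp [toPolyR_coeff]

lemma toPolyR_coeff_eq_self {p : ℝ[X]} {k : ℕ} (hp : p.Monic) (hk : p.natDegree = k) :
    (toPolyR k fun m ↦ p.coeff m) = p := by
  ext m
  rw [toPolyR_coeff]
  split_ifs with h₁ h₂
  · rfl
  · rw [h₂, ← hk, hp.coeff_natDegree]
  · exact (coeff_eq_zero_of_natDegree_lt (by omega)).symm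

lemma continuous_toPolyR_coeff (k m : ℕ) : Continuous fun c ↦ (toPolyR k c).coeff m := by
  simp only [toPolyR_coeff]
  split_ifs <;> fun_prop

/-- Coefficients of a monic factor of a real polynomial are bounded in terms of the coefficients
of the product. -/
lemma Polynomial.Monic.abs_coeff_le_of_mul {p q : ℝ[X]} (hp : p.Monic) (hq : q.Monic) {k : ℕ}
    {B : ℝ} (hk : (p * q).natDegree = k) (hB : ∀ m, |(p * q).coeff m| ≤ B) (m : ℕ) :
    |p.coeff m| ≤ 2 ^ k * ((k + 1) * B) := by
  have hv : Isometry (algebraMap ℝ ℂ) := algebraMap_isometry ℝ ℂ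
  have h₁ := norm_coeff_le_choose_mul_mapMahlerMeasure _ hv m p
  have h₂ : p.mapMahlerMeasure (algebraMap ℝ ℂ) ≤ (p * q).mapMahlerMeasure (algebraMap ℝ ℂ) := by
    rw [mapMahlerMeasure_mul]
    exact le_mul_of_one_le_right (mapMahlerMeasure_nonneg _ _) (hq.one_le_mapMahlerMeasure _ hv)
  have h₃ : (p * q).mapMahlerMeasure (algebraMap ℝ ℂ) ≤ (k + 1) * B := by
    refine (mapMahlerMeasure_le_sum_norm_coeff _ _ hv).trans ?_
    rw [sum_over_range _ (by simp), hk]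
    refine (Finset.sum_le_card_nsmul _ _ B fun m _ ↦ hB m).trans_eq ?_
    simp
  have h₄ : ((p.natDegree.choose m : ℕ) : ℝ) ≤ 2 ^ k := by
    have h : p.natDegree ≤ k := by rw [← hk, hp.natDegree_mul hq]; omega
    exact_mod_cast (Nat.choose_le_two_pow _ _).trans (Nat.pow_le_pow_right two_pos h)
  refine h₁.trans (mul_le_mul h₄ (h₂.trans h₃) (mapMahlerMeasure_nonneg _ _) (by positivity))

/-- The map `(g, (q_j)) ↦ (g * q_j)` on coefficient vectors of monic polynomials. -/
noncomputable def mulTuple (a b k n : ℕ) (x : (Fin a → ℝ) × (Fin (n + 1) → Fin b → ℝ)) :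
    Fin (n + 1) → Fin k → ℝ :=
  fun j m ↦ (toPolyR a x.1 * toPolyR b (x.2 j)).coeff m

lemma natDegree_toPolyR_mul {a b k : ℕ} (hab : a + b = k) (c : Fin a → ℝ) (d : Fin b → ℝ) :
    (toPolyR a c * toPolyR b d).natDegree = k := by
  rw [(monic_toPolyR a c).natDegree_mul (monic_toPolyR b d), natDegree_toPolyR, natDegree_toPolyR,
    hab]

lemma toPolyR_mulTuple {a b k n : ℕ} (hab : a + b = k)
    (x : (Fin a → ℝ) × (Fin (n + 1) → Fin b → ℝ)) (j : Fin (n + 1)) :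
    toPolyR k (mulTuple a b k n x j) = toPolyR a x.1 * toPolyR b (x.2 j) :=
  toPolyR_coeff_eq_self ((monic_toPolyR _ _).mul (monic_toPolyR _ _))
    (natDegree_toPolyR_mul hab _ _)

lemma continuous_mulTuple (a b k n : ℕ) : Continuous (mulTuple a b k n) := by
  refine continuous_pi fun j ↦ continuous_pi fun m ↦ ?_
  simp only [mulTuple, coeff_mul]
  refine continuous_finsetSum _ fun e _ ↦ ?_
  exact ((continuous_toPolyR_coeff a e.1).comp continuous_fst).mul
    ((continuous_toPolyR_coeff b e.2).comp ((continuous_apply j).comp continuous_snd))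

lemma isProperMap_mulTuple {a b k n : ℕ} (hab : a + b = k) : IsProperMap (mulTuple a b k n) := by
  refine isProperMap_iff_isCompact_preimage.2 ⟨continuous_mulTuple a b k n, fun K hK ↦ ?_⟩
  refine Metric.isCompact_of_isClosed_isBounded
    (hK.isClosed.preimage (continuous_mulTuple a b k n)) ?_
  obtain ⟨R, hR⟩ := hK.isBounded.exists_norm_le
  have hB : ∀ x ∈ mulTuple a b k n ⁻¹' K, ∀ j m,
      |(toPolyR a x.1 * toPolyR b (x.2 j)).coeff m| ≤ max 1 R := by
    intro x hx j m
    rw [← toPolyR_mulTuple hab, toPolyR_coeff]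
    split_ifs with h₁ h₂
    · exact ((norm_le_pi_norm _ _).trans (norm_le_pi_norm (mulTuple a b k n x) j)).trans
        ((hR _ hx).trans (le_max_right _ _))
    · simp
    · simp
  have hC : 0 ≤ (2 : ℝ) ^ k * ((k + 1) * max 1 R) := by positivity
  refine isBounded_iff_forall_norm_le.2 ⟨2 ^ k * ((k + 1) * max 1 R), fun x hx ↦ ?_⟩
  refine max_le ((pi_norm_le_iff_of_nonneg hC).2 fun m ↦ ?_)
    ((pi_norm_le_iff_of_nonneg hC).2 fun j ↦ (pi_norm_le_iff_of_nonneg hC).2 fun m ↦ ?_)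
  · rw [Real.norm_eq_abs, ← toPolyR_coeff_fin a x.1]
    exact (monic_toPolyR _ _).abs_coeff_le_of_mul (monic_toPolyR _ _)
      (natDegree_toPolyR_mul hab _ _) (hB x hx 0) m
  · rw [Real.norm_eq_abs, ← toPolyR_coeff_fin b (x.2 j)]
    refine (monic_toPolyR _ _).abs_coeff_le_of_mul (monic_toPolyR a x.1)
      (by rw [mul_comm, natDegree_toPolyR_mul hab]) (fun m ↦ ?_) m
    rw [mul_comm]
    exact hB x hx j m

lemma gcd_toPolyR_ne_zero {k n : ℕ} (f : Fin (n + 1) → Fin k → ℝ) :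
    (Finset.univ.gcd fun j ↦ toPolyR k (f j)) ≠ 0 := fun h ↦
  (monic_toPolyR k (f 0)).ne_zero (Finset.gcd_eq_zero_iff.1 h 0 (Finset.mem_univ 0))

lemma monic_gcd_toPolyR {k n : ℕ} (f : Fin (n + 1) → Fin k → ℝ) :
    (Finset.univ.gcd fun j ↦ toPolyR k (f j)).Monic := by
  rw [← Finset.normalize_gcd]
  exact monic_normalize (gcd_toPolyR_ne_zero f)

lemma gcd_mulTuple {a b k n : ℕ} (hab : a + b = k)
    (x : (Fin a → ℝ) × (Fin (n + 1) → Fin b → ℝ)) :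
    (Finset.univ.gcd fun j ↦ toPolyR k (mulTuple a b k n x j)) =
      toPolyR a x.1 * Finset.univ.gcd fun j ↦ toPolyR b (x.2 j) := by
  refine eq_of_monic_of_associated (monic_gcd_toPolyR _)
    ((monic_toPolyR _ _).mul (monic_gcd_toPolyR _)) ?_
  simp only [toPolyR_mulTuple hab]
  exact Finset.gcd_mul_left' Finset.univ (fun j ↦ toPolyR b (x.2 j)) _

lemma mem_RXset_zero_iff {b n : ℕ} (q : Fin (n + 1) → Fin b → ℝ) :
    q ∈ RXset b n 0 ↔ (Finset.univ.gcd fun j ↦ toPolyR b (q j)) = 1 := by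
  rw [RXset, Set.mem_ofPred_eq, Nat.le_zero, (monic_gcd_toPolyR q).natDegree_eq_zero]

/-- The tuples of monic polynomials of degree `k` with no common real root and with gcd of
degree exactly `a`. -/
def gcdStratum (k n a : ℕ) : Set (Fin (n + 1) → Fin k → ℝ) :=
  {f | (∀ x : ℝ, ∃ j, (toPolyR k (f j)).eval x ≠ 0) ∧
    (Finset.univ.gcd fun j => toPolyR k (f j)).natDegree = a}

lemma exists_eval_ne_zero_iff {k n : ℕ} (f : Fin (n + 1) → Fin k → ℝ) (x : ℝ) :
    (∃ j, (toPolyR k (f j)).eval x ≠ 0) ↔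
      (Finset.univ.gcd fun j => toPolyR k (f j)).eval x ≠ 0 := by
  rw [← not_iff_not]
  push Not
  change (∀ j, IsRoot _ x) ↔ IsRoot _ x
  simp only [← dvd_iff_isRoot, Finset.dvd_gcd_iff, Finset.mem_univ, true_implies]

lemma mulTuple_mem_gcdStratum_iff {a b k n : ℕ} (hab : a + b = k)
    (x : (Fin a → ℝ) × (Fin (n + 1) → Fin b → ℝ)) :
    mulTuple a b k n x ∈ gcdStratum k n a ↔
      (∀ t : ℝ, (toPolyR a x.1).eval t ≠ 0) ∧ x.2 ∈ RXset b n 0 := by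
  have h : (Finset.univ.gcd fun j => toPolyR k (mulTuple a b k n x j)).natDegree = a ↔
      x.2 ∈ RXset b n 0 := by
    rw [gcd_mulTuple hab, (monic_toPolyR _ _).natDegree_mul (monic_gcd_toPolyR _),
      natDegree_toPolyR, RXset, Set.mem_ofPred_eq]
    omega
  rw [gcdStratum, Set.mem_ofPred_eq, h]
  refine and_congr_left fun hx ↦ forall_congr' fun t ↦ ?_
  rw [exists_eval_ne_zero_iff, gcd_mulTuple hab, (mem_RXset_zero_iff _).1 hx, mul_one]

lemma mulTuple_injOn {a b k n : ℕ} (hab : a + b = k) :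
    Set.InjOn (mulTuple a b k n) {x | x.2 ∈ RXset b n 0} := by
  intro x hx y hy h
  have h₁ : x.1 = y.1 := toPolyR_injective a <| by
    have := gcd_mulTuple hab x
    rwa [h, gcd_mulTuple hab, (mem_RXset_zero_iff _).1 hx, (mem_RXset_zero_iff _).1 hy, mul_one,
      mul_one, eq_comm] at this
  refine Prod.ext h₁ (funext fun j ↦ toPolyR_injective b ?_)
  refine mul_left_cancel₀ (monic_toPolyR a x.1).ne_zero ?_
  rw [← toPolyR_mulTuple hab, h, toPolyR_mulTuple hab, h₁]

lemma exists_mulTuple_eq {a b k n : ℕ} (hab : a + b = k) {f : Fin (n + 1) → Fin k → ℝ}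
    (hf : f ∈ gcdStratum k n a) : ∃ x, mulTuple a b k n x = f := by
  have hd := monic_gcd_toPolyR f
  choose q hq using fun j ↦ Finset.gcd_dvd (f := fun j ↦ toPolyR k (f j)) (Finset.mem_univ j)
  have hqm (j) : (q j).Monic := hd.of_mul_monic_left (hq j ▸ monic_toPolyR k (f j))
  have hqd (j) : (q j).natDegree = b := by
    have := congrArg natDegree (hq j)
    rw [natDegree_toPolyR, hd.natDegree_mul (hqm j), hf.2] at this
    omega
  refine ⟨(fun m ↦ (Finset.univ.gcd fun j ↦ toPolyR k (f j)).coeff m, fun j m ↦ (q j).coeff m),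
    funext fun j ↦ toPolyR_injective k ?_⟩
  rw [toPolyR_mulTuple hab, toPolyR_coeff_eq_self hd hf.2, toPolyR_coeff_eq_self (hqm j) (hqd j)]
  exact (hq j).symm

/-- Pairs of a monic polynomial without real roots and a coprime tuple, as the preimage of a
gcd stratum under multiplication. -/
def prodHomeoPreimage {a b k : ℕ} (n : ℕ) (hab : a + b = k) :
    ({g : Fin a → ℝ // ∀ x : ℝ, (toPolyR a g).eval x ≠ 0} × ↥(RXset b n 0)) ≃ₜ
      ↥(mulTuple a b k n ⁻¹' gcdStratum k n a) where
  toFun x := ⟨(x.1.1, x.2.1), (mulTuple_mem_gcdStratum_iff hab _).2 ⟨x.1.2, x.2.2⟩⟩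
  invFun y := (⟨y.1.1, ((mulTuple_mem_gcdStratum_iff hab _).1 y.2).1⟩,
    ⟨y.1.2, ((mulTuple_mem_gcdStratum_iff hab _).1 y.2).2⟩)
  left_inv _ := rfl
  right_inv _ := rfl
  continuous_toFun := by fun_prop
  continuous_invFun := by fun_prop

lemma bijective_restrictPreimage_mulTuple {a b k : ℕ} (n : ℕ) (hab : a + b = k) :
    Function.Bijective ((gcdStratum k n a).restrictPreimage (mulTuple a b k n)) := by
  refine ⟨fun x y h ↦ Subtype.ext (mulTuple_injOn hab
    ((mulTuple_mem_gcdStratum_iff hab _).1 x.2).2 ((mulTuple_mem_gcdStratum_iff hab _).1 y.2).2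
    (congrArg Subtype.val h)), fun f ↦ ?_⟩
  obtain ⟨x, hx⟩ := exists_mulTuple_eq hab f.2
  exact ⟨⟨x, by rw [Set.mem_preimage, hx]; exact f.2⟩, Subtype.ext hx⟩

/-- **Lemma 3.3 (underlying decomposition).** The stratum `Y_{k,n}^{2i} − Y_{k,n}^{2i−2}` of
tuples of monic real degree-`k` polynomials with no common real root and gcd of degree exactly
`2i` is homeomorphic to {monic real polynomials of degree `2i` with no real roots} × `RX_{k−2i,n}^0`
via `(g, (q_0,…,q_n)) ↦ (g·q_0, …, g·q_n)`. -/
theorem stratum_homeo_Y (n k i : ℕ) (hn : 1 ≤ n) (hi : 2 * i ≤ k) :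
    ∃ H : ({g : Fin (2 * i) → ℝ // ∀ x : ℝ, (toPolyR (2 * i) g).eval x ≠ 0} ×
          ↥(RXset (k - 2 * i) n 0)) ≃ₜ
        ↥{f : Fin (n + 1) → Fin k → ℝ |
            (∀ x : ℝ, ∃ j, (toPolyR k (f j)).eval x ≠ 0) ∧
            (Finset.univ.gcd fun j => toPolyR k (f j)).natDegree = 2 * i},
      ∀ (g : {g : Fin (2 * i) → ℝ // ∀ x : ℝ, (toPolyR (2 * i) g).eval x ≠ 0})
        (q : ↥(RXset (k - 2 * i) n 0)) (j : Fin (n + 1)) (m : Fin k),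
        (H (g, q)).val j m = (toPolyR (2 * i) g.val * toPolyR (k - 2 * i) (q.val j)).coeff m := by
  have hab : 2 * i + (k - 2 * i) = k := by omega
  exact ⟨(prodHomeoPreimage n hab).trans
    ((Equiv.ofBijective _ (bijective_restrictPreimage_mulTuple n hab)).toHomeomorphOfContinuousClosed
      ((continuous_mulTuple _ _ _ _).restrictPreimage)
      ((isProperMap_mulTuple hab).isClosedMap.restrictPreimage _)), fun _ _ _ _ ↦ rfl⟩
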